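/- Let F = F̆(α_1,…,α_t) be a fence. Then the set B_A(F) = ∪_{i=1}^{t} {α_i·χ_x + χ_{s_{i−1}} + χ_{s_i} : x an unshared element of S_i} (with the convention that χ_{s_0} and χ_{s_t} are the zero function) is a basis of the antichain toggleability space A_T(F); in particular dim A_T(F) = Σ_{i=1}^{t} (α_i − 1). -/

import Mathlib

open scoped Classical

namespace Fence

/-- partial sums: `m α i = α 0 + ⋯ + α (i-1)` (the paper's `m_i`). -/
def m (α : ℕ → ℕ) (i : ℕ) : ℕ := ∑ k ∈ Finset.range i, α k

/-- the number `n` of elements of the fence `F̆(α)`. -/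
def nn (t : ℕ) (α : ℕ → ℕ) : ℕ := m α t - 1

/-- vertex type: index `0` is a dummy (used as sentinel for nonexistent elements);
the fence elements are the indices `1,…,nn t α`. -/
abbrev V (t : ℕ) (α : ℕ → ℕ) := Fin (nn t α + 1)

/-- the element `x_j` (1-based). -/
def xel (t : ℕ) (α : ℕ → ℕ) (j : ℕ) : V t α :=
  ⟨j % (nn t α + 1), Nat.mod_lt _ (Nat.succ_pos _)⟩

/-- `p` is an actual element of the fence (not the dummy `0`). -/
def Elem (t : ℕ) (α : ℕ → ℕ) (p : V t α) : Prop := 1 ≤ (p : ℕ)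

/-- the conditions on `(t, α)` for `F̆(α)` to be a fence. -/
def IsFence (t : ℕ) (α : ℕ → ℕ) : Prop :=
  2 ≤ t ∧ (∀ i < t, 1 ≤ α i) ∧ 2 ≤ α 0 ∧ 2 ≤ α (t - 1)

/-- the covering relation of the fence: `Cov t α a b` means `a ⋖ b`. -/
def Cov (t : ℕ) (α : ℕ → ℕ) (a b : V t α) : Prop :=
  ∃ i < t, ((i % 2 = 0 ∧ (b : ℕ) = (a : ℕ) + 1) ∨ (i % 2 = 1 ∧ (a : ℕ) = (b : ℕ) + 1)) ∧
    m α i ≤ min (a : ℕ) (b : ℕ) ∧ min (a : ℕ) (b : ℕ) < m α (i + 1) ∧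
    1 ≤ min (a : ℕ) (b : ℕ) ∧ max (a : ℕ) (b : ℕ) ≤ nn t α

/-- the order of the fence: reflexive–transitive closure of the covering relation. -/
def Le (t : ℕ) (α : ℕ → ℕ) : V t α → V t α → Prop := Relation.ReflTransGen (Cov t α)

/-- order ideals of the fence (as sets of actual elements, downward closed). -/
def IsIdeal (t : ℕ) (α : ℕ → ℕ) (I : Set (V t α)) : Prop :=
  (∀ p ∈ I, Elem t α p) ∧ ∀ a b : V t α, Le t α a b → b ∈ I → a ∈ I

/-- `J t α` is the set of order ideals of the fence. -/
abbrev J (t : ℕ) (α : ℕ → ℕ) := {I : Set (V t α) // IsIdeal t α I}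

/-- `p` is a maximal element of the set `I`. -/
def MaxIn (t : ℕ) (α : ℕ → ℕ) (I : Set (V t α)) (p : V t α) : Prop :=
  p ∈ I ∧ ∀ q ∈ I, Le t α p q → q = p

/-- `p` is a minimal element of the complement of `I` (among actual elements). -/
def MinOut (t : ℕ) (α : ℕ → ℕ) (I : Set (V t α)) (p : V t α) : Prop :=
  Elem t α p ∧ p ∉ I ∧ ∀ q : V t α, Elem t α q → q ∉ I → Le t α q p → q = p

/-- the order-ideal indicator function `χ̂_p`. -/
noncomputable def chiHat (t : ℕ) (α : ℕ → ℕ) (p : V t α) (I : J t α) : ℝ :=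
  if p ∈ I.1 then 1 else 0

/-- the antichain indicator function `χ_p`. -/
noncomputable def chi (t : ℕ) (α : ℕ → ℕ) (p : V t α) (I : J t α) : ℝ :=
  if MaxIn t α I.1 p then 1 else 0

/-- the toggleability statistic `T_p`. -/
noncomputable def Tg (t : ℕ) (α : ℕ → ℕ) (p : V t α) (I : J t α) : ℝ :=
  if MinOut t α I.1 p then 1 else if MaxIn t α I.1 p then -1 else 0

/-- the antichain toggleability statistic `T_A`. -/
noncomputable def TA (t : ℕ) (α : ℕ → ℕ) (A : Set (V t α)) (I : J t α) : ℝ :=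
  if ∀ p ∈ A, MinOut t α I.1 p then 1 else if ∀ p ∈ A, MaxIn t α I.1 p then -1 else 0

/-- `#[a,b]`: the number of elements `r` with `a ⊴ r ⊴ b`. -/
noncomputable def icard (t : ℕ) (α : ℕ → ℕ) (a b : V t α) : ℕ :=
  Set.ncard {r : V t α | Elem t α r ∧ Le t α a r ∧ Le t α r b}

/-- the span of the toggleability statistics `{T_p : p ∈ F}`. -/
noncomputable def ToggSpan (t : ℕ) (α : ℕ → ℕ) : Submodule ℝ (J t α → ℝ) :=
  Submodule.span ℝ {f | ∃ p : V t α, Elem t α p ∧ f = Tg t α p}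

/-- `f ≡ g`: `f - g` is an `ℝ`-linear combination of toggleability statistics. -/
def Equiv' (t : ℕ) (α : ℕ → ℕ) (f g : J t α → ℝ) : Prop := f - g ∈ ToggSpan t α

/-- statistics of the form `const + linear combination of toggleability statistics`. -/
noncomputable def ConstPlusTogg (t : ℕ) (α : ℕ → ℕ) : Submodule ℝ (J t α → ℝ) :=
  ToggSpan t α ⊔ Submodule.span ℝ {fun _ : J t α => (1 : ℝ)}

/-- the span of the antichain indicator functions `{χ_p : p ∈ F}`. -/
noncomputable def chiSpan (t : ℕ) (α : ℕ → ℕ) : Submodule ℝ (J t α → ℝ) :=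
  Submodule.span ℝ {f | ∃ p : V t α, Elem t α p ∧ f = chi t α p}

/-- the span of the order-ideal indicator functions `{χ̂_p : p ∈ F}`. -/
noncomputable def chiHatSpan (t : ℕ) (α : ℕ → ℕ) : Submodule ℝ (J t α → ℝ) :=
  Submodule.span ℝ {f | ∃ p : V t α, Elem t α p ∧ f = chiHat t α p}

/-- the antichain toggleability space `A_T(F)`. -/
noncomputable def AT (t : ℕ) (α : ℕ → ℕ) : Submodule ℝ (J t α → ℝ) :=
  chiSpan t α ⊓ ConstPlusTogg t α

/-- the order ideal toggleability space `I_T(F)`. -/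
noncomputable def IT (t : ℕ) (α : ℕ → ℕ) : Submodule ℝ (J t α → ℝ) :=
  chiHatSpan t α ⊓ ConstPlusTogg t α

/-- the shared element `s_i = x_{m_i}` (for `1 ≤ i ≤ t-1`); the sentinels `i = 0` and
`i = t` give the dummy vertex `0`, so statistics indexed by them vanish. -/
def sElx (t : ℕ) (α : ℕ → ℕ) (i : ℕ) : V t α := xel t α (m α i)

/-- 1-based index of the unshared element `s_{(i,j)}` (the `j`-th smallest unshared
element of the segment `S_i`, in the order of the fence). -/
def uEl (α : ℕ → ℕ) (i j : ℕ) : ℕ :=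
  if (i - 1) % 2 = 0 then m α (i - 1) + j else m α i - j

def uElx (t : ℕ) (α : ℕ → ℕ) (i j : ℕ) : V t α := xel t α (uEl α i j)

/-- 1-based index of the peak of segment `S_i` (sentinel `0` if it does not exist). -/
def peakN (t : ℕ) (α : ℕ → ℕ) (i : ℕ) : ℕ :=
  if i % 2 = 1 then (if i + 1 ≤ t then m α i else 0) else m α (i - 1)

/-- 1-based index of the valley of segment `S_i` (sentinel `0` if it does not exist). -/
def valleyN (t : ℕ) (α : ℕ → ℕ) (i : ℕ) : ℕ :=
  if i % 2 = 1 then (if 2 ≤ i then m α (i - 1) else 0) else (if i + 1 ≤ t then m α i else 0)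

def peakx (t : ℕ) (α : ℕ → ℕ) (i : ℕ) : V t α := xel t α (peakN t α i)
def valleyx (t : ℕ) (α : ℕ → ℕ) (i : ℕ) : V t α := xel t α (valleyN t α i)

/-- segment `S_i` has a peak. -/
def HasPeak (t i : ℕ) : Prop := i % 2 = 0 ∨ i + 1 ≤ t

/-- segment `S_i` has a valley. -/
def HasValley (t i : ℕ) : Prop := (i % 2 = 1 ∧ 2 ≤ i) ∨ (i % 2 = 0 ∧ i + 1 ≤ t)

/-- `p` is a shared element of the fence. -/
def IsSharedElem (t : ℕ) (α : ℕ → ℕ) (p : V t α) : Prop :=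
  ∃ i, 1 ≤ i ∧ i + 1 ≤ t ∧ p = sElx t α i

/-- `p` is a peak of the fence. -/
def IsPeakElem (t : ℕ) (α : ℕ → ℕ) (p : V t α) : Prop :=
  ∃ i, 1 ≤ i ∧ i + 1 ≤ t ∧ i % 2 = 1 ∧ p = sElx t α i

/-- span of the antichain indicators of the shared elements. -/
noncomputable def chiSharedSpan (t : ℕ) (α : ℕ → ℕ) : Submodule ℝ (J t α → ℝ) :=
  Submodule.span ℝ {f | ∃ i, 1 ≤ i ∧ i + 1 ≤ t ∧ f = chi t α (sElx t α i)}

/-- span of the order-ideal indicators of the shared elements. -/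
noncomputable def chiHatSharedSpan (t : ℕ) (α : ℕ → ℕ) : Submodule ℝ (J t α → ℝ) :=
  Submodule.span ℝ {f | ∃ i, 1 ≤ i ∧ i + 1 ≤ t ∧ f = chiHat t α (sElx t α i)}

theorem cov_elem {t : ℕ} {α : ℕ → ℕ} {a b : V t α} (h : Cov t α a b) :
    Elem t α a ∧ Elem t α b := by
  obtain ⟨i, hi, hd, h1, h2, h3, h4⟩ := h
  constructor <;> (simp only [Elem]; omega)

theorem le_elem {t : ℕ} {α : ℕ → ℕ} {a b : V t α} (h : Le t α a b) (hb : Elem t α b) :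
    Elem t α a := by
  induction h using Relation.ReflTransGen.head_induction_on with
  | refl => exact hb
  | head hc _ _ => exact (cov_elem hc).1

/-- rowmotion: `ρ(I)` is the order ideal generated by the minimal elements of the
complement of `I`. -/
noncomputable def rho (t : ℕ) (α : ℕ → ℕ) (I : J t α) : J t α :=
  ⟨{q | ∃ p : V t α, MinOut t α I.1 p ∧ Le t α q p}, by
    constructor
    · rintro q ⟨p, hp, hle⟩
      exact le_elem hle hp.1
    · rintro a b hab ⟨p, hp, hle⟩
      exact ⟨p, hp, Relation.ReflTransGen.trans hab hle⟩⟩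

/-- the (forward) orbit of `x` under `ρ`. -/
def orbit {X : Type*} (ρ : X → X) (x : X) : Set X := {y | ∃ k : ℕ, ρ^[k] x = y}

/-- `f` is `c`-mesic under `ρ`: the sum of `f` over each orbit is `c` times
the orbit size. -/
def IsMesic {X : Type*} (ρ : X → X) (f : X → ℝ) (c : ℝ) : Prop :=
  ∀ x : X, ∑ᶠ y ∈ orbit ρ x, f y = (orbit ρ x).ncard * c


/-- The set `B_A(F) = ⋃_{i=1}^t {α_i·χ_x + χ_{s_{i−1}} + χ_{s_i} : x ∈ unshared(S_i)}`
(the sentinel convention makes `χ_{s_0}` and `χ_{s_t}` the zero function). -/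
noncomputable def BA (t : ℕ) (α : ℕ → ℕ) : Set (J t α → ℝ) :=
  {f | ∃ i j, 1 ≤ i ∧ i ≤ t ∧ 1 ≤ j ∧ j ≤ α (i - 1) - 1 ∧
    f = fun I => (α (i - 1) : ℝ) * chi t α (uElx t α i j) I
          + chi t α (sElx t α (i - 1)) I + chi t α (sElx t α i) I}


/-! ### Segments and the direction of the fence -/

theorem m_mono (α : ℕ → ℕ) : Monotone (m α) := by
  intro a b h
  unfold m
  exact Finset.sum_le_sum_of_subset (Finset.range_mono h)

theorem m_succ (α : ℕ → ℕ) (i : ℕ) : m α (i + 1) = m α i + α i := Finset.sum_range_succ _ _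

theorem m_zero (α : ℕ → ℕ) : m α 0 = 0 := rfl

theorem seg_exists (α : ℕ → ℕ) (t k : ℕ) (h : k < m α t) :
    ∃ i < t, m α i ≤ k ∧ k < m α (i + 1) := by
  induction t with
  | zero => simp [m_zero] at h
  | succ t ih =>
    by_cases hk : k < m α t
    · obtain ⟨i, hi, h1⟩ := ih hk
      exact ⟨i, by omega, h1⟩
    · exact ⟨t, by omega, by omega, h⟩

theorem seg_unique (α : ℕ → ℕ) {i j k : ℕ} (h1 : m α i ≤ k) (h2 : k < m α (i + 1))
    (h3 : m α j ≤ k) (h4 : k < m α (j + 1)) : i = j := by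
  rcases lt_trichotomy i j with h | h | h
  · have := m_mono α (show i + 1 ≤ j from h); omega
  · exact h
  · have := m_mono α (show j + 1 ≤ i from h); omega

/-- the step from `x_k` to `x_{k+1}` goes up. -/
def up (t : ℕ) (α : ℕ → ℕ) (k : ℕ) : Prop :=
  ∃ i < t, i % 2 = 0 ∧ m α i ≤ k ∧ k < m α (i + 1)

theorem up_iff {t : ℕ} {α : ℕ → ℕ} {i k : ℕ} (hi : i < t) (h1 : m α i ≤ k)
    (h2 : k < m α (i + 1)) : up t α k ↔ i % 2 = 0 := by
  constructor
  · rintro ⟨j, _, hj, h3, h4⟩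
    rw [seg_unique α h1 h2 h3 h4]; exact hj
  · intro h
    exact ⟨i, hi, h, h1, h2⟩

theorem nn_succ {t : ℕ} {α : ℕ → ℕ} (hF : IsFence t α) : nn t α + 1 = m α t := by
  have h1 := m_mono α (show 1 ≤ t by have := hF.1; omega)
  have h2 := m_succ α 0
  have h3 := hF.2.2.1
  rw [m_zero] at h2
  unfold nn
  simp at h2
  omega

theorem cov_iff {t : ℕ} {α : ℕ → ℕ} (hF : IsFence t α) (a b : V t α) :
    Cov t α a b ↔ ((b : ℕ) = a + 1 ∧ up t α a ∧ 1 ≤ (a : ℕ)) ∨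
      ((a : ℕ) = b + 1 ∧ ¬ up t α b ∧ 1 ≤ (b : ℕ)) := by
  have hN := nn_succ hF
  have ha := a.2
  have hb := b.2
  constructor
  · rintro ⟨i, hi, (⟨h0, h⟩ | ⟨h0, h⟩), h1, h2, h3, h4⟩
    · left
      have e : min (a : ℕ) b = a := by omega
      rw [e] at h1 h2 h3
      exact ⟨h, (up_iff hi h1 h2).2 h0, h3⟩
    · right
      have e : min (a : ℕ) b = b := by omega
      rw [e] at h1 h2 h3
      refine ⟨h, ?_, h3⟩
      rw [up_iff hi h1 h2]; omega
  · rintro (⟨h, ⟨i, hi, h0, h1, h2⟩, h3⟩ | ⟨h, hu, h3⟩)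
    · have e : min (a : ℕ) b = a := by omega
      refine ⟨i, hi, Or.inl ⟨h0, h⟩, ?_, ?_, ?_, ?_⟩ <;> first | (rw [e]; assumption) | omega
    · have e : min (a : ℕ) b = b := by omega
      obtain ⟨i, hi, h1, h2⟩ := seg_exists α t b (by omega)
      rw [up_iff hi h1 h2] at hu
      refine ⟨i, hi, Or.inr ⟨by omega, h⟩, ?_, ?_, ?_, ?_⟩ <;> first | (rw [e]; assumption) | omega

/-! ### The rank function -/

noncomputable def rk (t : ℕ) (α : ℕ → ℕ) (k : ℕ) : ℤ :=
  ∑ j ∈ Finset.range k, if up t α j then 1 else -1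

theorem rk_succ (t : ℕ) (α : ℕ → ℕ) (k : ℕ) :
    rk t α (k + 1) = rk t α k + if up t α k then 1 else -1 := Finset.sum_range_succ _ _

theorem cov_rk {t : ℕ} {α : ℕ → ℕ} (hF : IsFence t α) {a b : V t α} (h : Cov t α a b) :
    rk t α a < rk t α b := by
  rcases (cov_iff hF a b).1 h with ⟨h1, h2, _⟩ | ⟨h1, h2, _⟩
  · rw [h1, rk_succ, if_pos h2]; omega
  · rw [h1, rk_succ, if_neg h2]; omega

theorem le_rk {t : ℕ} {α : ℕ → ℕ} (hF : IsFence t α) {a b : V t α} (h : Le t α a b) :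
    a = b ∨ rk t α a < rk t α b := by
  induction h with
  | refl => exact Or.inl rfl
  | tail _ hc ih =>
    have := cov_rk hF hc
    rcases ih with rfl | ih
    · exact Or.inr this
    · exact Or.inr (ih.trans this)

/-! ### Local characterisations -/

theorem maxIn_iff {t : ℕ} {α : ℕ → ℕ} (hF : IsFence t α) (I : J t α) (p : V t α) :
    MaxIn t α I.1 p ↔ p ∈ I.1 ∧ ∀ q, Cov t α p q → q ∉ I.1 := by
  constructor
  · rintro ⟨h1, h2⟩
    refine ⟨h1, fun q hc hq => ?_⟩
    have := h2 q hq (Relation.ReflTransGen.single hc)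
    have h3 := cov_rk hF hc
    rw [this] at h3
    exact lt_irrefl _ h3
  · rintro ⟨h1, h2⟩
    refine ⟨h1, fun q hq hle => ?_⟩
    rcases Relation.ReflTransGen.cases_head hle with h | ⟨r, hr, hrq⟩
    · exact h.symm
    · exact absurd (I.2.2 r q hrq hq) (h2 r hr)

theorem minOut_iff {t : ℕ} {α : ℕ → ℕ} (hF : IsFence t α) (I : J t α) (p : V t α) :
    MinOut t α I.1 p ↔ Elem t α p ∧ p ∉ I.1 ∧ ∀ q, Cov t α q p → q ∈ I.1 := by
  constructor
  · rintro ⟨h0, h1, h2⟩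
    refine ⟨h0, h1, fun q hc => ?_⟩
    by_contra hq
    have := h2 q (cov_elem hc).1 hq (Relation.ReflTransGen.single hc)
    have h3 := cov_rk hF hc
    rw [this] at h3
    exact lt_irrefl _ h3
  · rintro ⟨h0, h1, h2⟩
    refine ⟨h0, h1, fun q _ hq hle => ?_⟩
    rcases Relation.ReflTransGen.cases_tail hle with h | ⟨r, hqr, hr⟩
    · exact h.symm
    · exact absurd (I.2.2 q r hqr (h2 r hr)) hq

theorem xel_val {t : ℕ} {α : ℕ → ℕ} {k : ℕ} (h : k ≤ nn t α) : ((xel t α k : V t α) : ℕ) = k :=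
  Nat.mod_eq_of_lt (by omega)

theorem xel_self {t : ℕ} {α : ℕ → ℕ} (p : V t α) : xel t α p = p :=
  Fin.ext (Nat.mod_eq_of_lt p.2)

/-- extended membership indicator: `x_0` is always in, and `x_{n+1}` is in iff `t` is even. -/
noncomputable def Y (t : ℕ) (α : ℕ → ℕ) (I : J t α) (k : ℕ) : ℝ :=
  if k = 0 then 1 else if k ≤ nn t α then (if xel t α k ∈ I.1 then 1 else 0)
    else if t % 2 = 0 then 1 else 0

theorem Y_zero (t : ℕ) (α : ℕ → ℕ) (I : J t α) : Y t α I 0 = 1 := by simp [Y]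

theorem Y_mem {t : ℕ} {α : ℕ → ℕ} (I : J t α) {k : ℕ} (h1 : 1 ≤ k) (h2 : k ≤ nn t α) :
    Y t α I k = if xel t α k ∈ I.1 then 1 else 0 := by
  unfold Y
  rw [if_neg (by omega), if_pos h2]

theorem Y_last (t : ℕ) (α : ℕ → ℕ) (I : J t α) :
    Y t α I (nn t α + 1) = if t % 2 = 0 then 1 else 0 := by
  unfold Y
  rw [if_neg (by omega), if_neg (by omega)]

theorem Y_01 (t : ℕ) (α : ℕ → ℕ) (I : J t α) (k : ℕ) : Y t α I k = 0 ∨ Y t α I k = 1 := by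
  unfold Y
  split_ifs <;> simp

theorem up_zero {t : ℕ} {α : ℕ → ℕ} (hF : IsFence t α) : up t α 0 := by
  have h := hF.1
  have h1 := hF.2.2.1
  refine ⟨0, by omega, rfl, by simp [m_zero], ?_⟩
  rw [m_succ]; omega

theorem up_nn {t : ℕ} {α : ℕ → ℕ} (hF : IsFence t α) : up t α (nn t α) ↔ t % 2 = 1 := by
  have hN := nn_succ hF
  have h := hF.1
  have h1 := hF.2.2.2
  have h2 := m_succ α (t - 1)
  rw [Nat.sub_add_cancel (by omega)] at h2
  rw [up_iff (i := t - 1) (by omega) (by omega) (by rw [Nat.sub_add_cancel (by omega)]; omega)]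
  omega

theorem Y_up {t : ℕ} {α : ℕ → ℕ} (hF : IsFence t α) (I : J t α) {k : ℕ} (hk : k ≤ nn t α)
    (hu : up t α k) : Y t α I k * Y t α I (k + 1) = Y t α I (k + 1) := by
  rcases Nat.eq_zero_or_pos k with rfl | h0
  · rw [Y_zero, one_mul]
  rcases Nat.lt_or_ge k (nn t α) with h1 | h1
  · rw [Y_mem I h0 hk, Y_mem I (by omega) (by omega : k + 1 ≤ nn t α)]
    have hc : Cov t α (xel t α k) (xel t α (k + 1)) := by
      rw [cov_iff hF, xel_val hk, xel_val (by omega : k + 1 ≤ nn t α)]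
      exact Or.inl ⟨rfl, hu, h0⟩
    have := I.2.2 _ _ (Relation.ReflTransGen.single hc)
    split_ifs <;> simp_all
  · have : k = nn t α := by omega
    subst this
    rw [up_nn hF] at hu
    rw [Y_last, if_neg (by omega)]; simp

theorem Y_down {t : ℕ} {α : ℕ → ℕ} (hF : IsFence t α) (I : J t α) {k : ℕ} (hk : k ≤ nn t α)
    (hu : ¬ up t α k) : Y t α I k * Y t α I (k + 1) = Y t α I k := by
  rcases Nat.eq_zero_or_pos k with rfl | h0
  · exact absurd (up_zero hF) hu
  rcases Nat.lt_or_ge k (nn t α) with h1 | h1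
  · rw [Y_mem I h0 hk, Y_mem I (by omega) (by omega : k + 1 ≤ nn t α)]
    have hc : Cov t α (xel t α (k + 1)) (xel t α k) := by
      rw [cov_iff hF, xel_val hk, xel_val (by omega : k + 1 ≤ nn t α)]
      exact Or.inr ⟨rfl, hu, h0⟩
    have := I.2.2 _ _ (Relation.ReflTransGen.single hc)
    split_ifs <;> simp_all
  · have : k = nn t α := by omega
    subst this
    rw [up_nn hF] at hu
    rw [Y_last, if_pos (by omega)]; simp

theorem Y_eq_one {t : ℕ} {α : ℕ → ℕ} (I : J t α) (p : V t α) (hp : Elem t α p) :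
    Y t α I p = 1 ↔ p ∈ I.1 := by
  rw [Y_mem I hp (by omega), xel_self]
  split_ifs <;> simp_all

theorem maxIn_Y {t : ℕ} {α : ℕ → ℕ} (hF : IsFence t α) (I : J t α) {k : ℕ} (h1 : 1 ≤ k)
    (h2 : k ≤ nn t α) : MaxIn t α I.1 (xel t α k) ↔ Y t α I k = 1 ∧
      (up t α k → Y t α I (k + 1) = 0) ∧ (¬ up t α (k - 1) → Y t α I (k - 1) = 0) := by
  rw [maxIn_iff hF]
  have hel : ∀ j, 1 ≤ j → j ≤ nn t α → (xel t α j ∈ I.1 ↔ Y t α I j = 1) := by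
    intro j h1 h2
    rw [Y_mem I h1 h2]; split_ifs <;> simp_all
  have hne : ∀ j, Y t α I j = 0 ↔ ¬ Y t α I j = 1 := by
    intro j; rcases Y_01 t α I j with h | h <;> simp [h]
  rw [hel k h1 h2]
  refine and_congr_right fun _ => ?_
  constructor
  · intro h
    constructor
    · intro hu
      rcases Nat.lt_or_ge k (nn t α) with h3 | h3
      · rw [hne, ← hel _ (by omega) h3]
        apply h
        rw [cov_iff hF, xel_val h2, xel_val h3]
        exact Or.inl ⟨rfl, hu, h1⟩
      · have : k = nn t α := by omega
        subst this
        rw [up_nn hF] at hu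
        rw [Y_last, if_neg (by omega)]
    · intro hu
      have h0 : k - 1 ≠ 0 := by
        intro h0; rw [h0] at hu; exact hu (up_zero hF)
      rw [hne, ← hel _ (by omega) (by omega)]
      apply h
      rw [cov_iff hF, xel_val h2, xel_val (by omega)]
      exact Or.inr ⟨by omega, hu, by omega⟩
  · rintro ⟨hA, hB⟩ q hc hq
    have hqe := (cov_elem hc).2
    rw [cov_iff hF, xel_val h2] at hc
    rw [← Y_eq_one I q hqe] at hq
    rcases hc with ⟨e, hu, _⟩ | ⟨e, hu, _⟩
    · rw [e, hA hu] at hq; exact zero_ne_one hq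
    · have e' : (q : ℕ) = k - 1 := by omega
      rw [e'] at hq hu
      rw [hB hu] at hq; exact zero_ne_one hq

theorem minOut_Y {t : ℕ} {α : ℕ → ℕ} (hF : IsFence t α) (I : J t α) {k : ℕ} (h1 : 1 ≤ k)
    (h2 : k ≤ nn t α) : MinOut t α I.1 (xel t α k) ↔ Y t α I k = 0 ∧
      (¬ up t α k → Y t α I (k + 1) = 1) ∧ (up t α (k - 1) → Y t α I (k - 1) = 1) := by
  rw [minOut_iff hF]
  have hel : ∀ j, 1 ≤ j → j ≤ nn t α → (xel t α j ∈ I.1 ↔ Y t α I j = 1) := by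
    intro j h1 h2
    rw [Y_mem I h1 h2]; split_ifs <;> simp_all
  have hne : ∀ j, Y t α I j = 0 ↔ ¬ Y t α I j = 1 := by
    intro j; rcases Y_01 t α I j with h | h <;> simp [h]
  have hE : Elem t α (xel t α k) := by unfold Elem; rw [xel_val h2]; exact h1
  rw [hel k h1 h2, ← hne]
  simp only [hE, true_and]
  refine and_congr_right fun _ => ?_
  constructor
  · intro h
    constructor
    · intro hu
      rcases Nat.lt_or_ge k (nn t α) with h3 | h3
      · rw [← hel _ (by omega) h3]
        apply h
        rw [cov_iff hF, xel_val h2, xel_val h3]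
        exact Or.inr ⟨rfl, hu, h1⟩
      · have : k = nn t α := by omega
        subst this
        rw [up_nn hF] at hu
        rw [Y_last, if_pos (by omega)]
    · intro hu
      by_cases h0 : k - 1 = 0
      · rw [h0, Y_zero]
      rw [← hel _ (by omega) (by omega)]
      apply h
      rw [cov_iff hF, xel_val h2, xel_val (by omega)]
      exact Or.inl ⟨by omega, hu, by omega⟩
  · rintro ⟨hA, hB⟩ q hc
    have hqe := (cov_elem hc).1
    rw [cov_iff hF, xel_val h2] at hc
    rw [← Y_eq_one I q hqe]
    rcases hc with ⟨e, hu, _⟩ | ⟨e, hu, _⟩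
    · have e' : (q : ℕ) = k - 1 := by omega
      rw [e'] at hu ⊢
      exact hB hu
    · rw [e]; exact hA hu

/-! ### Polynomial formulas -/

theorem chi_uu {t : ℕ} {α : ℕ → ℕ} (hF : IsFence t α) (I : J t α) {k : ℕ} (h1 : 1 ≤ k)
    (h2 : k ≤ nn t α) (hd : up t α (k - 1)) (hu : up t α k) :
    chi t α (xel t α k) I = Y t α I k - Y t α I (k + 1) := by
  have e1 := Y_up hF I h2 hu
  unfold chi
  rw [maxIn_Y hF I h1 h2]
  rcases Y_01 t α I k with h | h <;> rcases Y_01 t α I (k + 1) with h' | h' <;> simp_all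

theorem chi_dd {t : ℕ} {α : ℕ → ℕ} (hF : IsFence t α) (I : J t α) {k : ℕ} (h1 : 1 ≤ k)
    (h2 : k ≤ nn t α) (hd : ¬ up t α (k - 1)) (hu : ¬ up t α k) :
    chi t α (xel t α k) I = Y t α I k - Y t α I (k - 1) := by
  have e1 := Y_down hF I (k := k - 1) (by omega) hd
  rw [Nat.sub_add_cancel h1] at e1
  unfold chi
  rw [maxIn_Y hF I h1 h2]
  rcases Y_01 t α I k with h | h <;> rcases Y_01 t α I (k - 1) with h' | h' <;> simp_all

theorem chi_peak {t : ℕ} {α : ℕ → ℕ} (hF : IsFence t α) (I : J t α) {k : ℕ} (h1 : 1 ≤ k)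
    (h2 : k ≤ nn t α) (hd : up t α (k - 1)) (hu : ¬ up t α k) :
    chi t α (xel t α k) I = Y t α I k := by
  unfold chi
  rw [maxIn_Y hF I h1 h2]
  rcases Y_01 t α I k with h | h <;> simp_all

theorem chi_valley {t : ℕ} {α : ℕ → ℕ} (hF : IsFence t α) (I : J t α) {k : ℕ} (h1 : 1 ≤ k)
    (h2 : k ≤ nn t α) (hd : ¬ up t α (k - 1)) (hu : up t α k) :
    chi t α (xel t α k) I = Y t α I k - Y t α I (k - 1) - Y t α I (k + 1)
      + Y t α I (k - 1) * Y t α I (k + 1) := by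
  have e0 := Y_up hF I h2 hu
  have e1 := Y_down hF I (k := k - 1) (by omega) hd
  rw [Nat.sub_add_cancel h1] at e1
  unfold chi
  rw [maxIn_Y hF I h1 h2]
  rcases Y_01 t α I k with h | h <;> rcases Y_01 t α I (k - 1) with h' | h' <;>
    rcases Y_01 t α I (k + 1) with h'' | h'' <;> simp_all

theorem Tg_flat {t : ℕ} {α : ℕ → ℕ} (hF : IsFence t α) (I : J t α) {k : ℕ} (h1 : 1 ≤ k)
    (h2 : k ≤ nn t α) (hu : up t α (k - 1) ↔ up t α k) :
    Tg t α (xel t α k) I = Y t α I (k - 1) - 2 * Y t α I k + Y t α I (k + 1) := by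
  unfold Tg
  rw [maxIn_Y hF I h1 h2, minOut_Y hF I h1 h2]
  by_cases h0 : up t α k
  · have e0 := Y_up hF I h2 h0
    have e1 := Y_up hF I (k := k - 1) (by omega) (hu.2 h0)
    rw [Nat.sub_add_cancel h1] at e1
    rcases Y_01 t α I k with h | h <;> rcases Y_01 t α I (k - 1) with h' | h' <;>
      rcases Y_01 t α I (k + 1) with h'' | h'' <;> simp_all <;> norm_num
  · have e0 := Y_down hF I h2 h0
    have e1 := Y_down hF I (k := k - 1) (by omega) (fun h => h0 (hu.1 h))
    rw [Nat.sub_add_cancel h1] at e1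
    rcases Y_01 t α I k with h | h <;> rcases Y_01 t α I (k - 1) with h' | h' <;>
      rcases Y_01 t α I (k + 1) with h'' | h'' <;> simp_all <;> norm_num

theorem Tg_peak {t : ℕ} {α : ℕ → ℕ} (hF : IsFence t α) (I : J t α) {k : ℕ} (h1 : 1 ≤ k)
    (h2 : k ≤ nn t α) (hd : up t α (k - 1)) (hu : ¬ up t α k) :
    Tg t α (xel t α k) I = Y t α I (k - 1) * Y t α I (k + 1) - 2 * Y t α I k := by
  unfold Tg
  rw [maxIn_Y hF I h1 h2, minOut_Y hF I h1 h2]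
  have e0 := Y_down hF I h2 hu
  have e1 := Y_up hF I (k := k - 1) (by omega) hd
  rw [Nat.sub_add_cancel h1] at e1
  rcases Y_01 t α I k with h | h <;> rcases Y_01 t α I (k - 1) with h' | h' <;>
    rcases Y_01 t α I (k + 1) with h'' | h'' <;> simp_all <;> norm_num

theorem Tg_valley {t : ℕ} {α : ℕ → ℕ} (hF : IsFence t α) (I : J t α) {k : ℕ} (h1 : 1 ≤ k)
    (h2 : k ≤ nn t α) (hd : ¬ up t α (k - 1)) (hu : up t α k) :
    Tg t α (xel t α k) I = 1 - 2 * Y t α I k + Y t α I (k - 1) + Y t α I (k + 1)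
      - Y t α I (k - 1) * Y t α I (k + 1) := by
  unfold Tg
  rw [maxIn_Y hF I h1 h2, minOut_Y hF I h1 h2]
  have e0 := Y_up hF I h2 hu
  have e1 := Y_down hF I (k := k - 1) (by omega) hd
  rw [Nat.sub_add_cancel h1] at e1
  rcases Y_01 t α I k with h | h <;> rcases Y_01 t α I (k - 1) with h' | h' <;>
    rcases Y_01 t α I (k + 1) with h'' | h'' <;> simp_all <;> norm_num

/-! ### Test ideals -/

theorem exists_ideal {t : ℕ} {α : ℕ → ℕ} (hF : IsFence t α) (a b : V t α)
    (ha : Elem t α a) (hb : Elem t α b) (h : rk t α a = rk t α b) (ε δ : Prop) :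
    IsIdeal t α {q | (Le t α q a ∨ Le t α q b) ∧ (q = a → ε) ∧ (q = b → δ)} := by
  constructor
  · rintro p ⟨h1 | h1, _⟩
    · exact le_elem h1 ha
    · exact le_elem h1 hb
  · rintro c d hcd ⟨h1, h2, h3⟩
    have key : ∀ x : V t α, c = x → rk t α x = rk t α a → d = x := by
      intro x hx hr
      subst hx
      rcases le_rk hF hcd with e | e
      · exact e.symm
      · exfalso
        rcases h1 with h1 | h1 <;> rcases le_rk hF h1 with e' | e'
        · rw [e'] at e; omega
        · omega
        · rw [e'] at e; omega
        · omega
    refine ⟨h1.imp (fun h => Relation.ReflTransGen.trans hcd h)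
      (fun h => Relation.ReflTransGen.trans hcd h), fun hc => h2 (key a hc rfl),
      fun hc => h3 (key b hc h.symm)⟩

theorem xel_elem {t : ℕ} {α : ℕ → ℕ} {k : ℕ} (h1 : 1 ≤ k) (h2 : k ≤ nn t α) :
    Elem t α (xel t α k) := by
  unfold Elem; rw [xel_val h2]; exact h1

theorem xel_inj {t : ℕ} {α : ℕ → ℕ} {k l : ℕ} (h1 : k ≤ nn t α) (h2 : l ≤ nn t α) :
    xel t α k = xel t α l ↔ k = l := by
  rw [Fin.ext_iff, xel_val h1, xel_val h2]

theorem four_ideals {t : ℕ} {α : ℕ → ℕ} (hF : IsFence t α) {a b : ℕ} (ha1 : 1 ≤ a)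
    (ha2 : a ≤ nn t α) (hb1 : 1 ≤ b) (hb2 : b ≤ nn t α) (h : rk t α a = rk t α b) (hab : a ≠ b) :
    ∃ (z : ℕ → ℝ) (I : Bool → Bool → J t α), ∀ e d k, Y t α (I e d) k =
      if k = a then (if e then 1 else 0) else if k = b then (if d then 1 else 0) else z k := by
  have hr : rk t α (xel t α a : V t α) = rk t α (xel t α b : V t α) := by
    rw [xel_val ha2, xel_val hb2, h]
  let I : Bool → Bool → J t α := fun e d => ⟨_, exists_ideal hF (xel t α a) (xel t α b)
    (xel_elem ha1 ha2) (xel_elem hb1 hb2) hr (e = true) (d = true)⟩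
  have hI : ∀ e d q, q ∈ (I e d).1 ↔ (Le t α q (xel t α a) ∨ Le t α q (xel t α b)) ∧
      (q = xel t α a → e = true) ∧ (q = xel t α b → d = true) := fun _ _ _ => Iff.rfl
  refine ⟨fun k => Y t α (I true true) k, I, fun e d k => ?_⟩
  have r1 : Le t α (xel t α a) (xel t α a) := Relation.ReflTransGen.refl
  have r2 : Le t α (xel t α b) (xel t α b) := Relation.ReflTransGen.refl
  split_ifs with h1 h2 h2 h3
  · subst h1; rw [Y_mem _ ha1 ha2, if_pos]
    rw [hI, xel_inj ha2 hb2]; simp_all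
  · subst h1; rw [Y_mem _ ha1 ha2, if_neg]
    rw [hI]; simp_all
  · subst h2; rw [Y_mem _ hb1 hb2, if_pos]
    rw [hI, xel_inj hb2 ha2]; simp_all
  · subst h2; rw [Y_mem _ hb1 hb2, if_neg]
    rw [hI]; simp_all
  · unfold Y
    by_cases h0 : k = 0
    · simp [h0]
    by_cases hk : k ≤ nn t α
    · simp only [if_neg h0, if_pos hk]
      simp only [hI, xel_inj hk ha2, xel_inj hk hb2, h1, h2]
      simp
    · simp only [if_neg h0, if_neg hk]

theorem two_ideals {t : ℕ} {α : ℕ → ℕ} (hF : IsFence t α) {a : ℕ} (ha1 : 1 ≤ a)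
    (ha2 : a ≤ nn t α) :
    ∃ (z : ℕ → ℝ) (I : Bool → J t α), ∀ e k, Y t α (I e) k =
      if k = a then (if e then 1 else 0) else z k := by
  let I : Bool → J t α := fun e => ⟨_, exists_ideal hF (xel t α a) (xel t α a)
    (xel_elem ha1 ha2) (xel_elem ha1 ha2) rfl (e = true) (e = true)⟩
  have hI : ∀ e q, q ∈ (I e).1 ↔ (Le t α q (xel t α a) ∨ Le t α q (xel t α a)) ∧
      (q = xel t α a → e = true) ∧ (q = xel t α a → e = true) := fun _ _ => Iff.rfl
  refine ⟨fun k => Y t α (I true) k, I, fun e k => ?_⟩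
  have r1 : Le t α (xel t α a) (xel t α a) := Relation.ReflTransGen.refl
  split_ifs with h1 h2
  · subst h1; rw [Y_mem _ ha1 ha2, if_pos]
    rw [hI]; simp_all
  · subst h1; rw [Y_mem _ ha1 ha2, if_neg]
    rw [hI]; simp_all
  · unfold Y
    by_cases h0 : k = 0
    · simp [h0]
    by_cases hk : k ≤ nn t α
    · simp only [if_neg h0, if_pos hk]
      simp only [hI, xel_inj hk ha2, h1]
      simp
    · simp only [if_neg h0, if_neg hk]

theorem principal {t : ℕ} {α : ℕ → ℕ} (hF : IsFence t α) {a : ℕ} (ha1 : 1 ≤ a)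
    (ha2 : a ≤ nn t α) :
    ∃ I : J t α, ∀ q, chi t α q I = if q = xel t α a then 1 else 0 := by
  refine ⟨⟨_, exists_ideal hF (xel t α a) (xel t α a)
    (xel_elem ha1 ha2) (xel_elem ha1 ha2) rfl True True⟩, fun q => ?_⟩
  unfold chi
  have r1 : Le t α (xel t α a) (xel t α a) := Relation.ReflTransGen.refl
  congr 1
  apply propext
  constructor
  · rintro ⟨h1, h2⟩
    have hq : Le t α q (xel t α a) := by simpa using h1
    exact (h2 (xel t α a) (by simpa using r1) hq).symm
  · rintro rfl
    refine ⟨by simpa using r1, fun q hq hle => ?_⟩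
    have hq' : Le t α q (xel t α a) := by simpa using hq
    rcases le_rk hF hle with e | e
    · exact e.symm
    · rcases le_rk hF hq' with e' | e'
      · exact e'
      · omega

/-! ### The main vanishing lemma -/

theorem discrete_max (n : ℕ) (w : ℕ → ℝ) (h0 : w 0 = 0) (hn : w (n + 1) = 0)
    (h : ∀ a, 1 ≤ a → a ≤ n → w a = 0 ∨ w (a - 1) - 2 * w a + w (a + 1) = 0) :
    ∀ k, k ≤ n + 1 → w k = 0 := by
  have hP : ∀ k, k ≤ n → 0 ≤ w k * (w (k + 1) - w k) := by
    intro k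
    induction k with
    | zero => intro _; simp [h0]
    | succ k ih =>
      intro hk
      have := ih (by omega)
      rcases h (k + 1) (by omega) hk with e | e
      · rw [e]; simp
      · simp only [Nat.add_sub_cancel] at e
        have e' : w (k + 1 + 1) - w (k + 1) = w (k + 1) - w k := by linarith
        rw [e']
        nlinarith [sq_nonneg (w (k + 1) - w k)]
  have hQ : ∀ j, j ≤ n + 1 → w (n + 1 - j) = 0 := by
    intro j
    induction j with
    | zero => intro _; simpa using hn
    | succ j ih =>
      intro hj
      have h1 := ih (by omega)
      have h2 := hP (n + 1 - (j + 1)) (by omega)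
      rw [show n + 1 - (j + 1) + 1 = n + 1 - j by omega, h1] at h2
      have : w (n + 1 - (j + 1)) ^ 2 ≤ 0 := by nlinarith
      exact pow_eq_zero_iff (two_ne_zero) |>.1 (le_antisymm this (sq_nonneg _))
  intro k hk
  have := hQ (n + 1 - k) (by omega)
  rwa [show n + 1 - (n + 1 - k) = k by omega] at this

/-- the interior of the fence: shared elements are neither first nor last. -/
theorem shared_interior {t : ℕ} {α : ℕ → ℕ} (hF : IsFence t α) {k : ℕ} (h1 : 1 ≤ k)
    (h2 : k ≤ nn t α) (hs : ¬ (up t α (k - 1) ↔ up t α k)) : 2 ≤ k ∧ k + 1 ≤ nn t α := by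
  have hN := nn_succ hF
  have ht := hF.1
  constructor
  · by_contra hk
    have : k = 1 := by omega
    subst this
    apply hs
    have h3 : up t α 1 := ⟨0, by omega, rfl, by simp [m_zero], by
      rw [m_succ, m_zero]; have := hF.2.2.1; omega⟩
    exact ⟨fun _ => h3, fun _ => up_zero hF⟩
  · by_contra hk
    have : k = nn t α := by omega
    subst this
    apply hs
    have h3 := hF.2.2.2
    have h4 := m_succ α (t - 1)
    rw [Nat.sub_add_cancel (by omega)] at h4
    rw [up_iff (i := t - 1) (by omega) (by omega) (by rw [Nat.sub_add_cancel (by omega)]; omega),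
      up_iff (i := t - 1) (by omega) (by omega) (by rw [Nat.sub_add_cancel (by omega)]; omega)]

theorem mixed_lin {p : ℕ} (z : ℕ → ℝ) (y : Bool → Bool → ℕ → ℝ)
    (hy : ∀ e d k, y e d k = if k = p - 1 then (if e then 1 else 0) else
      if k = p + 1 then (if d then 1 else 0) else z k) (j : ℕ) :
    y true true j - y true false j - y false true j + y false false j = 0 := by
  simp only [hy]
  by_cases h1 : j = p - 1
  · simp [h1]
  · by_cases h2 : j = p + 1
    · rw [if_neg h1, if_neg h1, if_neg h1, if_neg h1]; simp [h2]
    · simp [h1, h2]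

theorem mixed_quad {p : ℕ} (hp : 2 ≤ p) (z : ℕ → ℝ) (y : Bool → Bool → ℕ → ℝ)
    (hy : ∀ e d k, y e d k = if k = p - 1 then (if e then 1 else 0) else
      if k = p + 1 then (if d then 1 else 0) else z k) {k : ℕ} (hk : 1 ≤ k) :
    y true true (k - 1) * y true true (k + 1) - y true false (k - 1) * y true false (k + 1)
      - y false true (k - 1) * y false true (k + 1)
      + y false false (k - 1) * y false false (k + 1) = if k = p then 1 else 0 := by
  simp only [hy]
  by_cases h0 : k = p
  · subst h0
    have h1 : k + 1 ≠ k - 1 := by omega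
    simp [h1]
  · rw [if_neg h0]
    have a1 : ¬ (k - 1 = p - 1) := by omega
    have a2 : ¬ (k + 1 = p + 1) := by omega
    simp only [if_neg a1, if_neg a2]
    by_cases h1 : k - 1 = p + 1
    · have h2 : ¬ (k + 1 = p - 1) := by omega
      simp only [if_neg h2]
      ring
    · simp only [if_neg h1]
      ring

theorem mixed_term {t : ℕ} {α : ℕ → ℕ} (hF : IsFence t α) {p : ℕ} (hp1 : 2 ≤ p)
    (z : ℕ → ℝ) (I : Bool → Bool → J t α)
    (hI : ∀ e d k, Y t α (I e d) k = if k = p - 1 then (if e then 1 else 0) else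
      if k = p + 1 then (if d then 1 else 0) else z k)
    {k : ℕ} (hk1 : 1 ≤ k) (hk2 : k ≤ nn t α) (b s : ℝ)
    (hb : (up t α (k - 1) ↔ up t α k) → b = 0) (G : J t α → ℝ)
    (hG : ∀ I, G I = b * chi t α (xel t α k) I - s * Tg t α (xel t α k) I) :
    G (I true true) - G (I true false) - G (I false true) + G (I false false) =
      if k = p then (if up t α (k - 1) ↔ up t α k then 0 else
        if up t α k then b + s else - s) else 0 := by
  have L := mixed_lin z (fun e d k => Y t α (I e d) k) hI
  have Q := mixed_quad hp1 z (fun e d k => Y t α (I e d) k) hI hk1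
  have L0 := L (k - 1)
  have L1 := L k
  have L2 := L (k + 1)
  have e : ∀ x : ℝ, (if k = p then x else 0) = x * (if k = p then 1 else 0) := by
    intro x; split_ifs <;> simp
  rw [e, ← Q]
  by_cases hd : up t α (k - 1) <;> by_cases hu : up t α k
  · rw [hb (by tauto)] at hG
    rw [if_pos (by tauto)]
    simp only [hG, Tg_flat hF _ hk1 hk2 (by tauto : up t α (k - 1) ↔ up t α k)]
    linear_combination (-s) * (L0 - 2 * L1 + L2)
  · rw [if_neg (by tauto), if_neg hu]
    simp only [hG, Tg_peak hF _ hk1 hk2 hd hu, chi_peak hF _ hk1 hk2 hd hu]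
    linear_combination (b + 2 * s) * L1
  · rw [if_neg (by tauto), if_pos hu]
    simp only [hG, Tg_valley hF _ hk1 hk2 hd hu, chi_valley hF _ hk1 hk2 hd hu]
    linear_combination (b + 2 * s) * L1 - (b + s) * (L0 + L2)
  · rw [hb (by tauto)] at hG
    rw [if_pos (by tauto)]
    simp only [hG, Tg_flat hF _ hk1 hk2 (by tauto : up t α (k - 1) ↔ up t α k)]
    linear_combination (-s) * (L0 - 2 * L1 + L2)

theorem shared_vanish {t : ℕ} {α : ℕ → ℕ} (hF : IsFence t α) (b s : ℕ → ℝ) (c : ℝ)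
    (hb : ∀ k, (up t α (k - 1) ↔ up t α k) → b k = 0)
    (h : ∀ I : J t α, ∑ k ∈ Finset.Icc 1 (nn t α),
      (b k * chi t α (xel t α k) I - s k * Tg t α (xel t α k) I) = c) :
    ∀ k, 1 ≤ k → k ≤ nn t α → b k = 0 := by
  -- first step: quadratic coefficients
  have step1 : ∀ p, 1 ≤ p → p ≤ nn t α → ¬ (up t α (p - 1) ↔ up t α p) →
      (if up t α p then b p + s p else - s p) = 0 := by
    intro p hp1 hp2 hs
    obtain ⟨h3, h4⟩ := shared_interior hF hp1 hp2 hs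
    have hr : rk t α (p - 1) = rk t α (p + 1) := by
      have e := rk_succ t α (p - 1)
      rw [Nat.sub_add_cancel hp1] at e
      rw [rk_succ, e]
      by_cases hu : up t α p <;> by_cases hd : up t α (p - 1) <;> simp_all
    obtain ⟨z, I, hI⟩ := four_ideals hF (a := p - 1) (b := p + 1) (by omega) (by omega) (by omega)
      h4 hr (by omega)
    have e : ∑ k ∈ Finset.Icc 1 (nn t α), (if k = p then (if up t α (k - 1) ↔ up t α k then 0 else
        if up t α k then b k + s k else - s k) else 0) = 0 := by
      rw [← Finset.sum_congr rfl (fun k hk => mixed_term hF h3 z I hI (Finset.mem_Icc.1 hk).1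
        (Finset.mem_Icc.1 hk).2 (b k) (s k) (hb k)
        (fun I => b k * chi t α (xel t α k) I - s k * Tg t α (xel t α k) I) (fun _ => rfl))]
      rw [Finset.sum_add_distrib, Finset.sum_sub_distrib, Finset.sum_sub_distrib]
      simp only [h]
      ring
    rw [Finset.sum_ite_eq' , if_pos (Finset.mem_Icc.2 ⟨hp1, hp2⟩), if_neg hs] at e
    exact e
  -- second step: linear coefficients
  let w : ℕ → ℝ := fun k => if 1 ≤ k ∧ k ≤ nn t α ∧ (up t α (k - 1) ↔ up t α k) then s k else 0
  let sg : ℕ → ℝ := fun k => if up t α k then -1 else 1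
  have step2 : ∀ a, 1 ≤ a → a ≤ nn t α →
      sg a * b a - (w (a - 1) - 2 * w a + w (a + 1)) = 0 := by
    intro a ha1 ha2
    obtain ⟨z, I, hI⟩ := two_ideals hF ha1 ha2
    have term : ∀ k ∈ Finset.Icc 1 (nn t α),
        (b k * chi t α (xel t α k) (I true) - s k * Tg t α (xel t α k) (I true)) -
        (b k * chi t α (xel t α k) (I false) - s k * Tg t α (xel t α k) (I false)) =
        (if k = a then sg k * b k + 2 * w k else 0) - (if k = a + 1 then w k else 0)
          - (if k = a - 1 then w k else 0) := by
      intro k hk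
      obtain ⟨hk1, hk2⟩ := Finset.mem_Icc.1 hk
      have hs1 := step1 k hk1 hk2
      have hbk := hb k
      have L : ∀ j, Y t α (I true) j - Y t α (I false) j = if j = a then 1 else 0 := by
        intro j
        rw [hI, hI]
        split_ifs <;> simp_all
      have L0 := L (k - 1)
      have L1 := L k
      have L2 := L (k + 1)
      have e1 : (if k - 1 = a then (1 : ℝ) else 0) = if k = a + 1 then 1 else 0 := by
        congr 1; apply propext; omega
      have e2 : (if k + 1 = a then (1 : ℝ) else 0) = if k = a - 1 then 1 else 0 := by
        congr 1; apply propext; omega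
      have e : ∀ (P : Prop) [Decidable P] (x : ℝ),
          (if P then x else 0) = x * (if P then 1 else 0) := by
        intro P _ x; split_ifs <;> simp
      rw [e (k = a), e (k = a + 1), e (k = a - 1), ← e1, ← e2, ← L0, ← L1, ← L2]
      by_cases hs : up t α (k - 1) ↔ up t α k
      · have hwk : w k = s k := if_pos ⟨hk1, hk2, hs⟩
        rw [hbk hs, hwk, Tg_flat hF _ hk1 hk2 hs, Tg_flat hF _ hk1 hk2 hs]
        ring
      have hwk : w k = 0 := if_neg (by tauto)
      rw [hwk]
      by_cases hu : up t α k
      · have hd : ¬ up t α (k - 1) := by tauto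
        have hs : s k = - b k := by
          have : b k + s k = 0 := by simpa [hd, hu] using hs1
          linarith
        have hsg : sg k = -1 := if_pos hu
        rw [hs, hsg, Tg_valley hF _ hk1 hk2 hd hu, chi_valley hF _ hk1 hk2 hd hu,
          Tg_valley hF _ hk1 hk2 hd hu, chi_valley hF _ hk1 hk2 hd hu]
        ring
      · have hd : up t α (k - 1) := by tauto
        have hs : s k = 0 := by simpa [hd, hu] using hs1
        have hsg : sg k = 1 := if_neg hu
        rw [hs, hsg, chi_peak hF _ hk1 hk2 hd hu, chi_peak hF _ hk1 hk2 hd hu]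
        ring
    have e := Finset.sum_congr rfl term
    rw [Finset.sum_sub_distrib, h, h, Finset.sum_sub_distrib, Finset.sum_sub_distrib,
      Finset.sum_ite_eq', Finset.sum_ite_eq', Finset.sum_ite_eq',
      if_pos (Finset.mem_Icc.2 ⟨ha1, ha2⟩)] at e
    have e1 : (if a + 1 ∈ Finset.Icc 1 (nn t α) then w (a + 1) else 0) = w (a + 1) := by
      split_ifs with h5
      · rfl
      · rw [Finset.mem_Icc] at h5
        simp only [w]; rw [if_neg (by omega)]
    have e2 : (if a - 1 ∈ Finset.Icc 1 (nn t α) then w (a - 1) else 0) = w (a - 1) := by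
      split_ifs with h5
      · rfl
      · rw [Finset.mem_Icc] at h5
        simp only [w]; rw [if_neg (by omega)]
    rw [e1, e2] at e
    linarith
  have hw := discrete_max (nn t α) w (by simp [w]) (by simp [w]) (by
    intro a ha1 ha2
    by_cases hs : up t α (a - 1) ↔ up t α a
    · right
      have := step2 a ha1 ha2
      rw [hb a hs] at this
      linarith
    · left
      simp only [w]; rw [if_neg (by tauto)])
  intro k hk1 hk2
  have := step2 k hk1 hk2
  rw [hw (k - 1) (by omega), hw k (by omega), hw (k + 1) (by omega)] at this
  simp only [sg] at this
  split_ifs at this <;> linarith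

/-! ### Positions of shared and unshared elements -/

theorem unshared_pos {t : ℕ} {α : ℕ → ℕ} (hF : IsFence t α) {i k : ℕ} (hi : i < t)
    (h1 : m α i < k) (h2 : k < m α (i + 1)) :
    1 ≤ k ∧ k ≤ nn t α ∧ (up t α (k - 1) ↔ i % 2 = 0) ∧ (up t α k ↔ i % 2 = 0) := by
  have hN := nn_succ hF
  have h3 := m_mono α (show i + 1 ≤ t from hi)
  exact ⟨by omega, by omega, up_iff hi (by omega) (by omega), up_iff hi (by omega) h2⟩

theorem shared_pos {t : ℕ} {α : ℕ → ℕ} (hF : IsFence t α) {i : ℕ} (h1 : 1 ≤ i) (hi : i < t) :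
    1 ≤ m α i ∧ m α i ≤ nn t α ∧ (up t α (m α i - 1) ↔ i % 2 = 1) ∧
      (up t α (m α i) ↔ i % 2 = 0) := by
  have hN := nn_succ hF
  have e1 := m_succ α (i - 1)
  rw [Nat.sub_add_cancel h1] at e1
  have e2 := m_succ α i
  have a1 := hF.2.1 (i - 1) (by omega)
  have a2 := hF.2.1 i hi
  have h3 := m_mono α (show i + 1 ≤ t from hi)
  refine ⟨by omega, by omega, ?_, up_iff hi le_rfl (by omega)⟩
  rw [up_iff (i := i - 1) (by omega) (by omega) (by rw [Nat.sub_add_cancel h1]; omega)]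
  omega

theorem xel_zero_not_mem {t : ℕ} {α : ℕ → ℕ} (I : J t α) (p : V t α) (hp : (p : ℕ) = 0) :
    chi t α p I = 0 := by
  unfold chi
  rw [if_neg]
  rintro ⟨h, _⟩
  have := I.2.1 p h
  unfold Elem at this
  omega

theorem chi_sfirst {t : ℕ} {α : ℕ → ℕ} (I : J t α) : chi t α (sElx t α 0) I = 0 := by
  apply xel_zero_not_mem
  simp [sElx, xel, m_zero]

theorem chi_slast {t : ℕ} {α : ℕ → ℕ} (hF : IsFence t α) (I : J t α) :
    chi t α (sElx t α t) I = 0 := by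
  apply xel_zero_not_mem
  simp [sElx, xel, nn_succ hF]

/-- the element of `B_A` at the position `k` in the (0-based) segment `i`. -/
noncomputable def BF (t : ℕ) (α : ℕ → ℕ) (i k : ℕ) : J t α → ℝ := fun I =>
  (α i : ℝ) * chi t α (xel t α k) I + chi t α (sElx t α i) I + chi t α (sElx t α (i + 1)) I

theorem BA_iff {t : ℕ} {α : ℕ → ℕ} (f : J t α → ℝ) :
    f ∈ BA t α ↔ ∃ i k, i < t ∧ m α i < k ∧ k < m α (i + 1) ∧ f = BF t α i k := by
  constructor
  · rintro ⟨i, j, h1, h2, h3, h4, rfl⟩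
    have e := m_succ α (i - 1)
    rw [Nat.sub_add_cancel h1] at e
    refine ⟨i - 1, uEl α i j, by omega, ?_, ?_, ?_⟩
    · unfold uEl; split_ifs <;> omega
    · rw [Nat.sub_add_cancel h1]; unfold uEl; split_ifs <;> omega
    · unfold BF uElx
      rw [Nat.sub_add_cancel h1]
  · rintro ⟨i, k, h1, h2, h3, rfl⟩
    have e := m_succ α i
    by_cases hp : i % 2 = 0
    · refine ⟨i + 1, k - m α i, by omega, by omega, by omega, ?_, ?_⟩
      · simp only [Nat.add_sub_cancel]; omega
      · have : uEl α (i + 1) (k - m α i) = k := by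
          unfold uEl
          simp only [Nat.add_sub_cancel, if_pos hp]; omega
        unfold BF uElx
        rw [this]; simp only [Nat.add_sub_cancel]
    · refine ⟨i + 1, m α (i + 1) - k, by omega, by omega, by omega, ?_, ?_⟩
      · simp only [Nat.add_sub_cancel]; omega
      · have : uEl α (i + 1) (m α (i + 1) - k) = k := by
          unfold uEl
          simp only [Nat.add_sub_cancel, if_neg hp]; omega
        unfold BF uElx
        rw [this]; simp only [Nat.add_sub_cancel]

/-! ### `B_A` is contained in `A_T` -/

theorem second_diff {M : Type*} [AddCommGroup M] [Module ℝ M] (S : Submodule ℝ M) (Z : ℕ → M)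
    (a n : ℕ) (h : ∀ k, a < k → k < a + n → Z (k - 1) - (2 : ℝ) • Z k + Z (k + 1) ∈ S)
    (k : ℕ) (hk : k < n) : (n : ℝ) • (Z (a + k + 1) - Z (a + k)) - (Z (a + n) - Z a) ∈ S := by
  have A : ∀ k, k < n → (Z (a + k + 1) - Z (a + k)) - (Z (a + 1) - Z a) ∈ S := by
    intro k
    induction k with
    | zero => intro _; simp
    | succ k ih =>
      intro hk
      have h1 := S.add_mem (ih (by omega)) (h (a + (k + 1)) (by omega) (by omega))
      rw [show a + (k + 1) - 1 = a + k by omega] at h1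
      convert h1 using 1
      rw [show a + k + 1 = a + (k + 1) by omega]
      module
  have B : ∀ l, l ≤ n → (l : ℝ) • (Z (a + 1) - Z a) - (Z (a + l) - Z a) ∈ S := by
    intro l
    induction l with
    | zero => intro _; simp
    | succ l ih =>
      intro hl
      have h1 := S.sub_mem (ih (by omega)) (A l (by omega))
      convert h1 using 1
      push_cast
      rw [show a + (l + 1) = a + l + 1 by omega]
      module
  have h1 := S.add_mem (S.smul_mem (n : ℝ) (A k hk)) (B n le_rfl)
  convert h1 using 1
  module

theorem Tg_mem {t : ℕ} {α : ℕ → ℕ} {k : ℕ} (h1 : 1 ≤ k) (h2 : k ≤ nn t α) :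
    Tg t α (xel t α k) ∈ ConstPlusTogg t α :=
  (le_sup_left : ToggSpan t α ≤ _) (Submodule.subset_span ⟨_, xel_elem h1 h2, rfl⟩)

theorem const_mem (t : ℕ) (α : ℕ → ℕ) (c : ℝ) :
    (fun _ : J t α => c) ∈ ConstPlusTogg t α := by
  have h : (fun _ : J t α => (1 : ℝ)) ∈ ConstPlusTogg t α :=
    (le_sup_right : _ ≤ ConstPlusTogg t α) (Submodule.subset_span rfl)
  convert Submodule.smul_mem _ c h using 1
  ext; simp

theorem end_odd {t : ℕ} {α : ℕ → ℕ} (hF : IsFence t α) {i : ℕ} (hi : i ≤ t) (ho : i % 2 = 1)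
    (I : J t α) : chi t α (sElx t α i) I = Y t α I (m α i) := by
  rcases Nat.lt_or_ge i t with h | h
  · obtain ⟨h1, h2, h3, h4⟩ := shared_pos hF (i := i) (by omega) h
    exact chi_peak hF I h1 h2 (h3.2 ho) (by rw [h4]; omega)
  · have : i = t := by omega
    subst this
    rw [chi_slast hF, ← nn_succ hF, Y_last, if_neg (by omega)]

theorem end_even {t : ℕ} {α : ℕ → ℕ} (hF : IsFence t α) {i : ℕ} (hi : i ≤ t) (ho : i % 2 = 0) :
    (fun I => chi t α (sElx t α i) I + Y t α I (m α i)) ∈ ConstPlusTogg t α := by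
  rcases Nat.eq_zero_or_pos i with rfl | h0
  · convert const_mem t α 1 using 1
    ext I
    rw [chi_sfirst, m_zero, Y_zero]; simp
  rcases Nat.lt_or_ge i t with h | h
  · obtain ⟨h1, h2, h3, h4⟩ := shared_pos hF (i := i) h0 h
    convert Submodule.sub_mem _ (const_mem t α 1) (Tg_mem h1 h2) using 1
    ext I
    have hd : ¬ up t α (m α i - 1) := by rw [h3]; omega
    simp only [sElx, Pi.sub_apply]
    rw [chi_valley hF I h1 h2 hd (h4.2 ho), Tg_valley hF I h1 h2 hd (h4.2 ho)]
    ring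
  · have : i = t := by omega
    subst this
    convert const_mem i α 1 using 1
    ext I
    rw [chi_slast hF, ← nn_succ hF, Y_last, if_pos ho]; simp

theorem chi_mem {t : ℕ} {α : ℕ → ℕ} (p : V t α) : chi t α p ∈ chiSpan t α := by
  by_cases h : Elem t α p
  · exact Submodule.subset_span ⟨p, h, rfl⟩
  · have : chi t α p = 0 := by
      ext I
      exact xel_zero_not_mem I p (by unfold Elem at h; omega)
    rw [this]
    exact Submodule.zero_mem _

theorem BF_eq (t : ℕ) (α : ℕ → ℕ) (i k : ℕ) : BF t α i k = (α i : ℝ) • chi t α (xel t α k)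
    + chi t α (sElx t α i) + chi t α (sElx t α (i + 1)) := by
  ext I; simp [BF]

theorem BF_mem {t : ℕ} {α : ℕ → ℕ} (hF : IsFence t α) {i k : ℕ} (hi : i < t)
    (h1 : m α i < k) (h2 : k < m α (i + 1)) : BF t α i k ∈ AT t α := by
  have e := m_succ α i
  refine ⟨?_, ?_⟩
  · rw [BF_eq]
    exact Submodule.add_mem _ (Submodule.add_mem _ (Submodule.smul_mem _ _ (chi_mem _))
      (chi_mem _)) (chi_mem _)
  · show BF t α i k ∈ ConstPlusTogg t α
    have hS := second_diff (ConstPlusTogg t α) (fun k I => Y t α I k) (m α i) (α i) (by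
      intro l hl1 hl2
      obtain ⟨a1, a2, a3, a4⟩ := unshared_pos hF hi hl1 (by omega)
      convert Tg_mem (α := α) a1 a2 using 1
      ext I
      rw [Tg_flat hF I a1 a2 (a3.trans a4.symm)]
      simp)
    obtain ⟨a1, a2, a3, a4⟩ := unshared_pos hF hi h1 h2
    by_cases hp : i % 2 = 0
    · have h3 := hS (k - m α i) (by omega)
      rw [show m α i + (k - m α i) = k by omega, ← e] at h3
      convert Submodule.sub_mem _ (end_even hF hi.le hp) h3 using 1
      ext I
      simp only [BF, Pi.sub_apply, Pi.smul_apply, smul_eq_mul]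
      rw [end_odd hF (i := i + 1) hi (by omega), chi_uu hF I a1 a2 (a3.2 hp) (a4.2 hp)]
      ring
    · have h3 := hS (k - 1 - m α i) (by omega)
      rw [show m α i + (k - 1 - m α i) = k - 1 by omega, ← e, Nat.sub_add_cancel a1] at h3
      convert Submodule.add_mem _ (end_even hF (i := i + 1) hi (by omega)) h3 using 1
      ext I
      simp only [BF, Pi.sub_apply, Pi.add_apply, Pi.smul_apply, smul_eq_mul]
      rw [end_odd hF (i := i) hi.le (by omega),
        chi_dd hF I a1 a2 (by rw [a3]; omega) (by rw [a4]; omega)]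
      ring

/-! ### Spanning -/

theorem chi_mem_sup {t : ℕ} {α : ℕ → ℕ} (hF : IsFence t α) (i : ℕ) (hi : i ≤ t) :
    chi t α (sElx t α i) ∈ chiSharedSpan t α := by
  rcases Nat.eq_zero_or_pos i with rfl | h0
  · have : chi t α (sElx t α 0) = 0 := by ext I; exact chi_sfirst I
    rw [this]; exact Submodule.zero_mem _
  rcases Nat.lt_or_ge i t with h | h
  · exact Submodule.subset_span ⟨i, h0, h, rfl⟩
  · have : i = t := by omega
    subst this
    have : chi i α (sElx i α i) = 0 := by ext I; exact chi_slast hF I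
    rw [this]; exact Submodule.zero_mem _

theorem chiSpan_le {t : ℕ} {α : ℕ → ℕ} (hF : IsFence t α) :
    chiSpan t α ≤ Submodule.span ℝ (BA t α) ⊔ chiSharedSpan t α := by
  unfold chiSpan
  rw [Submodule.span_le]
  rintro f ⟨p, hp, rfl⟩
  have hN := nn_succ hF
  have hp2 := p.2
  obtain ⟨i, hi, h1, h2⟩ := seg_exists α t p (by omega)
  rcases Nat.eq_or_lt_of_le h1 with h | h
  · have : p = sElx t α i := by
      unfold sElx; rw [h, xel_self]
    rw [this]
    exact (le_sup_right : chiSharedSpan t α ≤ _) (chi_mem_sup hF i hi.le)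
  · have hB : BF t α i p ∈ Submodule.span ℝ (BA t α) ⊔ chiSharedSpan t α :=
      (le_sup_left : Submodule.span ℝ (BA t α) ≤ _)
        (Submodule.subset_span ((BA_iff _).2 ⟨i, p, hi, h, h2, rfl⟩))
    have hs : ∀ j, j ≤ t → chi t α (sElx t α j) ∈ Submodule.span ℝ (BA t α) ⊔ chiSharedSpan t α :=
      fun j hj => (le_sup_right : chiSharedSpan t α ≤ _) (chi_mem_sup hF j hj)
    have h3 := Submodule.smul_mem _ ((α i : ℝ)⁻¹)
      (Submodule.sub_mem _ (Submodule.sub_mem _ hB (hs i hi.le)) (hs (i + 1) hi))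
    have hα : (α i : ℝ) ≠ 0 := by
      have := hF.2.1 i hi
      positivity
    show chi t α p ∈ Submodule.span ℝ (BA t α) ⊔ chiSharedSpan t α
    convert h3 using 1
    rw [BF_eq, xel_self]
    rw [add_sub_right_comm, add_sub_cancel_right, add_sub_cancel_right, smul_smul,
      inv_mul_cancel₀ hα, one_smul]

theorem shared_coeff {t : ℕ} {α : ℕ → ℕ} (hF : IsFence t α) {f : J t α → ℝ}
    (hf : f ∈ chiSharedSpan t α) : ∃ b : ℕ → ℝ, (∀ k, (up t α (k - 1) ↔ up t α k) → b k = 0) ∧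
      ∀ I, f I = ∑ k ∈ Finset.Icc 1 (nn t α), b k * chi t α (xel t α k) I := by
  unfold chiSharedSpan at hf
  induction hf using Submodule.span_induction with
  | mem f hf =>
    obtain ⟨i, h1, h2, rfl⟩ := hf
    obtain ⟨a1, a2, a3, a4⟩ := shared_pos hF h1 h2
    refine ⟨fun k => if k = m α i then 1 else 0, fun k hk => if_neg ?_, fun I => ?_⟩
    · rintro rfl
      rw [a3, a4] at hk
      omega
    · simp only [ite_mul, one_mul, zero_mul]
      rw [Finset.sum_ite_eq', if_pos (Finset.mem_Icc.2 ⟨a1, a2⟩)]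
      rfl
  | zero => exact ⟨0, by simp, by simp⟩
  | add f g _ _ hf hg =>
    obtain ⟨b, h1, h2⟩ := hf
    obtain ⟨c, h3, h4⟩ := hg
    refine ⟨b + c, fun k hk => by simp [h1 k hk, h3 k hk], fun I => ?_⟩
    simp [h2, h4, add_mul, Finset.sum_add_distrib]
  | smul r f _ hf =>
    obtain ⟨b, h1, h2⟩ := hf
    refine ⟨r • b, fun k hk => by simp [h1 k hk], fun I => ?_⟩
    simp [h2, Finset.mul_sum, mul_assoc]

theorem togg_coeff {t : ℕ} {α : ℕ → ℕ} {f : J t α → ℝ}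
    (hf : f ∈ ToggSpan t α) : ∃ s : ℕ → ℝ,
      ∀ I, f I = ∑ k ∈ Finset.Icc 1 (nn t α), s k * Tg t α (xel t α k) I := by
  unfold ToggSpan at hf
  induction hf using Submodule.span_induction with
  | mem f hf =>
    obtain ⟨p, hp, rfl⟩ := hf
    refine ⟨fun k => if k = (p : ℕ) then 1 else 0, fun I => ?_⟩
    simp only [ite_mul, one_mul, zero_mul]
    rw [Finset.sum_ite_eq', if_pos (Finset.mem_Icc.2 ⟨hp, by omega⟩), xel_self]
  | zero => exact ⟨0, by simp⟩
  | add f g _ _ hf hg =>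
    obtain ⟨b, h2⟩ := hf
    obtain ⟨c, h4⟩ := hg
    refine ⟨b + c, fun I => ?_⟩
    simp [h2, h4, add_mul, Finset.sum_add_distrib]
  | smul r f _ hf =>
    obtain ⟨b, h2⟩ := hf
    refine ⟨r • b, fun I => ?_⟩
    simp [h2, Finset.mul_sum, mul_assoc]

theorem shared_inf {t : ℕ} {α : ℕ → ℕ} (hF : IsFence t α) {f : J t α → ℝ}
    (hf : f ∈ chiSharedSpan t α) (hc : f ∈ ConstPlusTogg t α) : f = 0 := by
  obtain ⟨b, hb, hfb⟩ := shared_coeff hF hf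
  obtain ⟨g, hg, c, hcc, hgc⟩ := Submodule.mem_sup.1 hc
  obtain ⟨r, rfl⟩ := Submodule.mem_span_singleton.1 hcc
  obtain ⟨s, hs⟩ := togg_coeff hg
  have := shared_vanish hF b s r hb (by
    intro I
    rw [Finset.sum_sub_distrib, ← hfb, ← hs, ← hgc]
    simp)
  ext I
  rw [hfb]
  apply Finset.sum_eq_zero
  intro k hk
  rw [this k (Finset.mem_Icc.1 hk).1 (Finset.mem_Icc.1 hk).2, zero_mul]

theorem span_BA {t : ℕ} {α : ℕ → ℕ} (hF : IsFence t α) :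
    Submodule.span ℝ (BA t α) = AT t α := by
  have h1 : Submodule.span ℝ (BA t α) ≤ AT t α := by
    rw [Submodule.span_le]
    intro f hf
    obtain ⟨i, k, hi, hk1, hk2, rfl⟩ := (BA_iff f).1 hf
    exact BF_mem hF hi hk1 hk2
  apply le_antisymm h1
  intro f hf
  obtain ⟨g, hg, h, hh, rfl⟩ := Submodule.mem_sup.1 (chiSpan_le hF hf.1)
  have h2 : h ∈ ConstPlusTogg t α := by
    have := Submodule.sub_mem _ hf.2 (h1 hg).2
    rwa [add_sub_cancel_left] at this
  rw [shared_inf hF hh h2, add_zero]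
  exact hg

/-! ### Linear independence -/

noncomputable def BS (t : ℕ) (α : ℕ → ℕ) (x : (i : Fin t) × Fin (α i - 1)) : J t α → ℝ :=
  BF t α x.1 (m α x.1 + 1 + x.2)

theorem range_BS (t : ℕ) (α : ℕ → ℕ) : Set.range (BS t α) = BA t α := by
  ext f
  rw [BA_iff]
  constructor
  · rintro ⟨⟨i, j⟩, rfl⟩
    have e := m_succ α i
    have hj := j.2
    exact ⟨i, m α i + 1 + j, i.2, by omega, by omega, rfl⟩
  · rintro ⟨i, k, hi, h1, h2, rfl⟩
    have e := m_succ α i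
    refine ⟨⟨⟨i, hi⟩, ⟨k - m α i - 1, ?_⟩⟩, ?_⟩
    · show _ < α i - 1
      omega
    · unfold BS
      simp only
      congr 1
      omega

theorem linInd_BS {t : ℕ} {α : ℕ → ℕ} (hF : IsFence t α) : LinearIndependent ℝ (BS t α) := by
  rw [Fintype.linearIndependent_iff]
  intro g hg x
  have hN := nn_succ hF
  have pos : ∀ y : (i : Fin t) × Fin (α i - 1), m α y.1 < m α y.1 + 1 + y.2 ∧
      m α y.1 + 1 + y.2 < m α (y.1 + 1) := by
    intro y
    have e := m_succ α y.1
    have hj := y.2.2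
    constructor <;> omega
  obtain ⟨a1, a2, a3, a4⟩ := unshared_pos hF x.1.2 (pos x).1 (pos x).2
  obtain ⟨I, hI⟩ := principal hF a1 a2
  have hs : ∀ i, i ≤ t → chi t α (sElx t α i) I = 0 := by
    intro i hi
    rcases Nat.eq_zero_or_pos i with rfl | h0
    · exact chi_sfirst I
    rcases Nat.lt_or_ge i t with h | h
    · obtain ⟨b1, b2, b3, b4⟩ := shared_pos hF h0 h
      rw [hI, if_neg]
      unfold sElx
      rw [xel_inj b2 a2]
      intro e
      rw [← e] at a3 a4
      rw [b3] at a3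
      rw [b4] at a4
      omega
    · have : i = t := by omega
      rw [this]; exact chi_slast hF I
  have h1 := congrFun hg I
  rw [Finset.sum_apply] at h1
  rw [Finset.sum_eq_single x] at h1
  · simp only [Pi.smul_apply, BS, BF, smul_eq_mul, Pi.zero_apply] at h1
    rw [hs _ x.1.2.le, hs _ x.1.2, hI, if_pos rfl] at h1
    have hα := hF.2.1 x.1 x.1.2
    have hα' : (α x.1 : ℝ) ≠ 0 := by positivity
    simpa [hα'] using h1
  · intro y _ hyx
    simp only [Pi.smul_apply, BS, BF, smul_eq_mul]
    rw [hs _ y.1.2.le, hs _ y.1.2, hI, if_neg]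
    · simp
    · obtain ⟨c1, c2, _, _⟩ := unshared_pos hF y.1.2 (pos y).1 (pos y).2
      rw [xel_inj c2 a2]
      intro e
      apply hyx
      have p1 := pos x
      have p2 := pos y
      have e1 : (y.1 : ℕ) = x.1 :=
        seg_unique α p2.1.le p2.2 (by omega) (by omega)
      obtain ⟨y1, y2⟩ := y
      obtain ⟨x1, x2⟩ := x
      have e2 : y1 = x1 := Fin.ext e1
      subst e2
      simp only at e
      have : y2 = x2 := Fin.ext (by omega)
      rw [this]
  · intro h; exact absurd (Finset.mem_univ _) h

/-- Theorem `ac togg dim`.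
`B_A(F)` is a basis of the antichain toggleability space `A_T(F)`; in particular
`dim A_T(F) = Σ_{i=1}^t (α_i − 1)`. -/
theorem statement4 (t : ℕ) (α : ℕ → ℕ) (hF : IsFence t α) :
    BA t α ⊆ (AT t α : Set (J t α → ℝ))
    ∧ LinearIndependent ℝ (fun f : BA t α => (f : J t α → ℝ))
    ∧ Submodule.span ℝ (BA t α) = AT t α
    ∧ Module.finrank ℝ (AT t α) = ∑ i ∈ Finset.range t, (α i - 1) := by
  have hli := linInd_BS hF
  refine ⟨?_, ?_, span_BA hF, ?_⟩
  · rw [← span_BA hF]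
    exact Submodule.subset_span
  · have := hli.linearIndepOn_id
    rw [range_BS] at this
    exact this
  · rw [← span_BA hF, ← range_BS, finrank_span_eq_card hli]
    simp [Finset.sum_range]

end Fence
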